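/- Proposition 2 (radial asymptotics of bi-brackets): if s_1 > r_1 + 1 and s_j ≥ r_j + 1 for j = 2,…,l, then the bi-bracket [s_1,…,s_l; r_1,…,r_l](q) satisfies lim_{q→1⁻} (1−q)^{s_1+⋯+s_l} [s_1,…,s_l; r_1,…,r_l](q) = ζ(s_1−r_1, s_2−r_2, …, s_l−r_l) / (r_1! r_2! ⋯ r_l!). -/

import Mathlib

open Filter
open scoped Nat

/-- The bi-bracket `[s₁,…,s_l; r₁,…,r_l](q)`. -/
noncomputable def biBracket (l : ℕ) (s r : Fin l → ℕ) (q : ℝ) : ℝ :=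
  (∏ j : Fin l, ((r j)! : ℝ) * ((s j - 1)! : ℝ))⁻¹ *
    ∑' x : {n : Fin l → ℕ // (∀ i j, i < j → n j < n i) ∧ ∀ i, 0 < n i} × (Fin l → ℕ+),
      (∏ j : Fin l, (x.1.1 j : ℝ) ^ (r j) * ((x.2 j : ℕ) : ℝ) ^ (s j - 1)) *
        q ^ (∑ j : Fin l, x.1.1 j * (x.2 j : ℕ))

/-- The multiple zeta value `ζ(a₁,…,a_l)`. -/
noncomputable def MZV (l : ℕ) (a : Fin l → ℕ) : ℝ :=
  ∑' n : {n : Fin l → ℕ // (∀ i j, i < j → n j < n i) ∧ ∀ i, 0 < n i},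
    ∏ j : Fin l, (1 : ℝ) / ((n.1 j : ℝ) ^ (a j))

/-- The power series `∑_{d ≥ 1} d ^ k x ^ d`. -/
noncomputable def powGeomSum (k : ℕ) (x : ℝ) : ℝ := ∑' d : ℕ+, ((d : ℕ) : ℝ) ^ k * x ^ (d : ℕ)

theorem summable_pnat_pow_mul_geometric (k : ℕ) {x : ℝ} (h0 : 0 ≤ x) (h1 : x < 1) :
    Summable fun d : ℕ+ => ((d : ℕ) : ℝ) ^ k * x ^ (d : ℕ) :=
  (summable_pow_mul_geometric_of_norm_lt_one k (r := x)
    (by rwa [Real.norm_of_nonneg h0])).comp_injective PNat.coe_injective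

theorem powGeomSum_nonneg (k : ℕ) {x : ℝ} (h0 : 0 ≤ x) : 0 ≤ powGeomSum k x :=
  tsum_nonneg fun _ => by positivity

theorem powGeomSum_eq_tsum_nat (k : ℕ) (x : ℝ) :
    powGeomSum k x = ∑' m : ℕ, ((m : ℝ) + 1) ^ k * x ^ (m + 1) := by
  rw [powGeomSum, tsum_pnat_eq_tsum_succ (f := fun d : ℕ => (d : ℝ) ^ k * x ^ d)]
  simp

theorem summable_succ_pow_mul_geometric (k : ℕ) {x : ℝ} (h0 : 0 ≤ x) (h1 : x < 1) :
    Summable fun m : ℕ => ((m : ℝ) + 1) ^ k * x ^ (m + 1) := by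
  simpa using (summable_nat_add_iff 1).2
    (summable_pow_mul_geometric_of_norm_lt_one k (r := x) (by rwa [Real.norm_of_nonneg h0]))

theorem one_sub_pow_mul_powGeomSum_le (k : ℕ) {x : ℝ} (h0 : 0 ≤ x) (h1 : x < 1) :
    (1 - x) ^ (k + 1) * powGeomSum k x ≤ k ! * x := by
  have hx : ‖x‖ < 1 := by rwa [Real.norm_of_nonneg h0]
  have hpos : 0 < (1 - x) ^ (k + 1) := pow_pos (sub_pos.2 h1) _
  have key : powGeomSum k x ≤ ∑' m : ℕ, (k ! * x) * (((m + k).choose k : ℝ) * x ^ m) := by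
    rw [powGeomSum_eq_tsum_nat]
    refine (summable_succ_pow_mul_geometric k h0 h1).tsum_le_tsum (fun m => ?_)
      ((summable_choose_mul_geometric_of_norm_lt_one k hx).mul_left _)
    have h : ((m : ℝ) + 1) ^ k ≤ k ! * ((m + k).choose k : ℝ) := by
      have := Nat.pow_succ_le_ascFactorial (m + 1) k
      rw [Nat.ascFactorial_eq_factorial_mul_choose] at this
      exact_mod_cast this
    calc ((m : ℝ) + 1) ^ k * x ^ (m + 1) ≤ (k ! * ((m + k).choose k : ℝ)) * x ^ (m + 1) := by gcongr
      _ = _ := by ring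
  rw [tsum_mul_left, tsum_choose_mul_geometric_of_norm_lt_one k hx] at key
  calc _ ≤ (1 - x) ^ (k + 1) * (k ! * x * (1 / (1 - x) ^ (k + 1))) := by gcongr
    _ = _ := by field_simp

theorem le_one_sub_pow_mul_powGeomSum (k : ℕ) {x : ℝ} (h0 : 0 ≤ x) (h1 : x < 1) :
    k ! * x ^ (k + 1) ≤ (1 - x) ^ (k + 1) * powGeomSum k x := by
  have hx : ‖x‖ < 1 := by rwa [Real.norm_of_nonneg h0]
  have hpos : 0 < (1 - x) ^ (k + 1) := pow_pos (sub_pos.2 h1) _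
  have key : ∑' m : ℕ, (k ! * x ^ (k + 1)) * (((m + k).choose k : ℝ) * x ^ m)
      ≤ powGeomSum k x := by
    rw [powGeomSum_eq_tsum_nat]
    have hs := summable_succ_pow_mul_geometric k h0 h1
    rw [← hs.sum_add_tsum_nat_add k]
    refine le_add_of_nonneg_of_le (Finset.sum_nonneg fun _ _ => by positivity) ?_
    refine ((summable_choose_mul_geometric_of_norm_lt_one k hx).mul_left _).tsum_le_tsum
      (fun m => ?_) ((summable_nat_add_iff k).2 hs)
    have h : k ! * ((m + k).choose k : ℝ) ≤ (((m + k : ℕ) : ℝ) + 1) ^ k := by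
      have := (Nat.descFactorial_le_pow (m + k) k).trans (Nat.pow_le_pow_left (Nat.le_succ _) k)
      rw [Nat.descFactorial_eq_factorial_mul_choose] at this
      exact_mod_cast this
    calc _ = (k ! * ((m + k).choose k : ℝ)) * x ^ (m + k + 1) := by ring
      _ ≤ _ := by gcongr
  rw [tsum_mul_left, tsum_choose_mul_geometric_of_norm_lt_one k hx] at key
  calc _ = (1 - x) ^ (k + 1) * (k ! * x ^ (k + 1) * (1 / (1 - x) ^ (k + 1))) := by field_simp
    _ ≤ _ := by gcongr

theorem one_sub_pow_mul_powGeomSum_pow_le (k : ℕ) {n : ℕ} (hn : 0 < n) {q : ℝ} (h0 : 0 < q)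
    (h1 : q < 1) :
    (1 - q) ^ (k + 1) * powGeomSum k (q ^ n) ≤
      (k ! * (k + 1)! * Real.exp 1) * (1 / (n : ℝ) ^ (k + 1)) := by
  have hn' : (0 : ℝ) < n := Nat.cast_pos.2 hn
  set u : ℝ := n * (1 - q) with hu
  have hu0 : 0 < u := mul_pos hn' (sub_pos.2 h1)
  set x : ℝ := q ^ n with hx
  have hx0 : 0 < x := pow_pos h0 n
  have hx1 : x < 1 := pow_lt_one₀ h0.le h1 hn.ne'
  have hxe : x ≤ Real.exp (-u) := by
    calc x ≤ Real.exp (-(1 - q)) ^ n := by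
          have := Real.one_sub_le_exp_neg (1 - q)
          exact pow_le_pow_left₀ h0.le (by linarith) n
      _ = Real.exp (-u) := by rw [← Real.exp_nat_mul, hu]; congr 1; ring
  have hux : (1 + u) * x ≤ 1 := by
    calc (1 + u) * x ≤ Real.exp u * Real.exp (-u) := by
          gcongr
          linarith [Real.add_one_le_exp u]
      _ = 1 := by rw [← Real.exp_add]; simp
  have hule : u ≤ (1 + u) * (1 - x) := by linarith
  have hL := powGeomSum_nonneg k hx0.le
  have hpow : (1 + u) ^ (k + 1) ≤ (k + 1)! * Real.exp (1 + u) := by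
    have := Real.pow_div_factorial_le_exp (1 + u) (by positivity) (k + 1)
    rwa [div_le_iff₀' (by positivity)] at this
  rw [mul_one_div, le_div_iff₀ (by positivity)]
  calc _ = u ^ (k + 1) * powGeomSum k x := by rw [hu, mul_pow]; ring
    _ ≤ ((1 + u) * (1 - x)) ^ (k + 1) * powGeomSum k x := by gcongr
    _ = (1 + u) ^ (k + 1) * ((1 - x) ^ (k + 1) * powGeomSum k x) := by rw [mul_pow]; ring
    _ ≤ ((k + 1)! * Real.exp (1 + u)) * (k ! * Real.exp (-u)) := by
        have := one_sub_pow_mul_powGeomSum_le k hx0.le hx1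
        have h1x : 0 ≤ 1 - x := by linarith
        exact mul_le_mul hpow (this.trans (by gcongr)) (by positivity) (by positivity)
    _ = k ! * (k + 1)! * (Real.exp (1 + u) * Real.exp (-u)) := by ring
    _ = _ := by rw [← Real.exp_add]; simp

theorem tendsto_one_sub_pow_mul_powGeomSum (k : ℕ) :
    Tendsto (fun x : ℝ => (1 - x) ^ (k + 1) * powGeomSum k x) (nhdsWithin 1 (Set.Iio 1))
      (nhds (k ! : ℝ)) := by
  have hmem : ∀ᶠ x : ℝ in nhdsWithin 1 (Set.Iio 1), x ∈ Set.Ioo (0 : ℝ) 1 :=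
    Ioo_mem_nhdsLT one_pos
  refine tendsto_of_tendsto_of_tendsto_of_le_of_le'
    (g := fun x : ℝ => k ! * x ^ (k + 1)) (h := fun x : ℝ => k ! * x) ?_ ?_
    (hmem.mono fun x hx => le_one_sub_pow_mul_powGeomSum k hx.1.le hx.2)
    (hmem.mono fun x hx => one_sub_pow_mul_powGeomSum_le k hx.1.le hx.2)
  · have : Continuous fun x : ℝ => (k ! : ℝ) * x ^ (k + 1) := by fun_prop
    simpa using (this.tendsto 1).mono_left nhdsWithin_le_nhds
  · have : Continuous fun x : ℝ => (k ! : ℝ) * x := by fun_prop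
    simpa using (this.tendsto 1).mono_left nhdsWithin_le_nhds

theorem tendsto_one_sub_pow_mul_powGeomSum_pow (k : ℕ) {n : ℕ} (hn : 0 < n) :
    Tendsto (fun q : ℝ => (1 - q) ^ (k + 1) * powGeomSum k (q ^ n)) (nhdsWithin 1 (Set.Iio 1))
      (nhds ((k ! : ℝ) * (1 / (n : ℝ) ^ (k + 1)))) := by
  have hmem : ∀ᶠ x : ℝ in nhdsWithin 1 (Set.Iio 1), x ∈ Set.Ioo (0 : ℝ) 1 :=
    Ioo_mem_nhdsLT one_pos
  have hn' : (n : ℝ) ≠ 0 := Nat.cast_ne_zero.2 hn.ne'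
  have hpow : Tendsto (fun q : ℝ => q ^ n) (nhdsWithin 1 (Set.Iio 1))
      (nhdsWithin 1 (Set.Iio 1)) := by
    refine tendsto_nhdsWithin_iff.2 ⟨?_, hmem.mono fun q hq => pow_lt_one₀ hq.1.le hq.2 hn.ne'⟩
    simpa using ((continuous_pow n).tendsto (1 : ℝ)).mono_left nhdsWithin_le_nhds
  have hgeom : Tendsto (fun q : ℝ => (1 / ∑ i ∈ Finset.range n, q ^ i) ^ (k + 1))
      (nhdsWithin 1 (Set.Iio 1)) (nhds ((1 / (n : ℝ)) ^ (k + 1))) := by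
    have hc : Continuous fun q : ℝ => ∑ i ∈ Finset.range n, q ^ i := by fun_prop
    have := (hc.tendsto 1).mono_left (nhdsWithin_le_nhds (s := Set.Iio 1))
    simp only [one_pow, Finset.sum_const, Finset.card_range, nsmul_eq_mul, mul_one] at this
    exact (tendsto_const_nhds.div this hn').pow _
  have := ((tendsto_one_sub_pow_mul_powGeomSum k).comp hpow).mul hgeom
  rw [one_div_pow] at this
  refine this.congr' (hmem.mono fun q hq => ?_)
  have hS : 0 < ∑ i ∈ Finset.range n, q ^ i :=
    Finset.sum_pos (fun i _ => pow_pos hq.1 i) (Finset.nonempty_range_iff.2 hn.ne')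
  simp only [Function.comp_apply]
  rw [← mul_neg_geom_sum q n, mul_pow, one_div_pow]
  field_simp

theorem hasSum_pi_prod_of_nonneg {α : Type*} {l : ℕ} (f : Fin l → α → ℝ) (h0 : ∀ j a, 0 ≤ f j a)
    (hf : ∀ j, Summable (f j)) :
    HasSum (fun x : Fin l → α => ∏ j, f j (x j)) (∏ j, ∑' a, f j a) := by
  induction l with
  | zero => simp
  | succ l ih =>
    rw [← (Fin.consEquiv fun _ => α).hasSum_iff, Fin.prod_univ_succ]
    have ih' := ih (fun j => f j.succ) (fun j => h0 j.succ) fun j => hf j.succ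
    have hnonneg : 0 ≤ fun x : Fin l → α => ∏ j, f j.succ (x j) :=
      fun x => Finset.prod_nonneg fun j _ => h0 j.succ _
    have hsummable := Summable.mul_of_nonneg (hf 0) ih'.summable (h0 0) hnonneg
    have hmul := HasSum.mul (hf 0).hasSum ih' hsummable
    have hcons : (fun x : Fin (l + 1) → α => ∏ j, f j (x j)) ∘ Fin.consEquiv (fun _ => α) =
        fun x => f 0 x.1 * ∏ j : Fin l, f j.succ (x.2 j) := by
      funext x
      simp [Fin.consEquiv, Fin.prod_univ_succ]
    rw [hcons]
    exact hmul

theorem summable_MZV {l : ℕ} (hl : 0 < l) (a : Fin l → ℕ) (h1 : 2 ≤ a ⟨0, hl⟩)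
    (ha : ∀ j, 1 ≤ a j) :
    Summable fun n : {n : Fin l → ℕ // (∀ i j, i < j → n j < n i) ∧ ∀ i, 0 < n i} =>
      ∏ j : Fin l, (1 : ℝ) / ((n.1 j : ℝ) ^ (a j)) := by
  have hl' : (0 : ℝ) < l := Nat.cast_pos.2 hl
  have hs : Summable fun m : ℕ => 1 / (m : ℝ) ^ (1 + 1 / (l : ℝ)) :=
    Real.summable_one_div_nat_rpow.2 (by linarith [one_div_pos.2 hl'])
  have hsum := (hasSum_pi_prod_of_nonneg (l := l) (fun _ (m : ℕ) => 1 / (m : ℝ) ^ (1 + 1 / (l : ℝ)))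
    (fun _ _ => by positivity) fun _ => hs).summable
  refine Summable.of_nonneg_of_le (fun n => Finset.prod_nonneg fun _ _ => by positivity)
    (fun n => ?_) (hsum.comp_injective Subtype.val_injective)
  obtain ⟨n, hlt, hpos⟩ := n
  simp only [Function.comp_apply, Finset.prod_div_distrib, Finset.prod_const_one]
  have hp : ∀ j, (1 : ℝ) ≤ n j := fun j => Nat.one_le_cast.2 (hpos j)
  have hp0 : ∀ j, (0 : ℝ) < n j := fun j => one_pos.trans_le (hp j)
  refine one_div_le_one_div_of_le
    (Finset.prod_pos fun j _ => Real.rpow_pos_of_pos (hp0 j) _) ?_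
  set z : Fin l := ⟨0, hl⟩ with hz
  have hle : ∀ j, (n j : ℝ) ≤ n z := fun j => by
    rcases eq_or_ne j z with rfl | h
    · exact le_rfl
    · exact_mod_cast (hlt z j (Fin.lt_def.2 (Nat.pos_of_ne_zero fun h' => h (Fin.ext h')))).le
  calc ∏ j, (n j : ℝ) ^ (1 + 1 / (l : ℝ))
      = (∏ j, (n j : ℝ)) * ∏ j, (n j : ℝ) ^ (1 / (l : ℝ)) := by
        rw [← Finset.prod_mul_distrib]
        exact Finset.prod_congr rfl fun j _ => by rw [Real.rpow_add (hp0 j), Real.rpow_one]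
    _ ≤ (∏ j, (n j : ℝ)) * ∏ _j : Fin l, (n z : ℝ) ^ (1 / (l : ℝ)) := by
        gcongr with j
        exact_mod_cast hle j
    _ = (∏ j, (n j : ℝ)) * n z := by
        rw [Finset.prod_const, Finset.card_univ, Fintype.card_fin, ← Real.rpow_natCast,
          ← Real.rpow_mul (hp0 z).le, one_div_mul_cancel hl'.ne', Real.rpow_one]
    _ = ∏ j, (n j : ℝ) ^ (1 + if j = z then 1 else 0) := by
        simp_rw [pow_add, Finset.prod_mul_distrib]
        simp
    _ ≤ ∏ j, (n j : ℝ) ^ a j := by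
        gcongr with j
        · exact hp j
        · split_ifs with h
          · exact h ▸ h1
          · exact ha j

theorem hasSum_biBracket_fiber {l : ℕ} (s r n : Fin l → ℕ) (hn : ∀ j, 0 < n j) {q : ℝ}
    (h0 : 0 < q) (h1 : q < 1) :
    HasSum (fun d : Fin l → ℕ+ =>
        (∏ j : Fin l, (n j : ℝ) ^ (r j) * ((d j : ℕ) : ℝ) ^ (s j - 1)) *
          q ^ (∑ j : Fin l, n j * (d j : ℕ)))
      (∏ j, (n j : ℝ) ^ r j * powGeomSum (s j - 1) (q ^ n j)) := by
  have := hasSum_pi_prod_of_nonneg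
    (fun j (d : ℕ+) => (n j : ℝ) ^ r j * (((d : ℕ) : ℝ) ^ (s j - 1) * (q ^ n j) ^ (d : ℕ)))
    (fun j d => by positivity)
    (fun j => (summable_pnat_pow_mul_geometric _ (by positivity)
      (pow_lt_one₀ h0.le h1 (hn j).ne')).mul_left _)
  simp only [tsum_mul_left] at this
  convert this using 2 with d
  · rw [← Finset.prod_pow_eq_pow_sum, ← Finset.prod_mul_distrib]
    exact Finset.prod_congr rfl fun j _ => by rw [pow_mul]; ring
  · simp only [powGeomSum]

theorem one_sub_pow_mul_biBracket_term_le {l : ℕ} (s r n : Fin l → ℕ) (hj : ∀ j, r j + 1 ≤ s j)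
    (hn : ∀ j, 0 < n j) {q : ℝ} (h0 : 0 < q) (h1 : q < 1) :
    (1 - q) ^ (∑ j, s j) * ∏ j, (n j : ℝ) ^ r j * powGeomSum (s j - 1) (q ^ n j) ≤
      (∏ j, ((s j - 1)! * (s j)! * Real.exp 1)) * ∏ j, 1 / (n j : ℝ) ^ (s j - r j) := by
  rw [← Finset.prod_pow_eq_pow_sum, ← Finset.prod_mul_distrib, ← Finset.prod_mul_distrib]
  refine Finset.prod_le_prod (fun j _ => ?_) fun j _ => ?_
  · have := powGeomSum_nonneg (s j - 1) (pow_nonneg h0.le (n j))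
    have := sub_pos.2 h1
    positivity
  · have hnj : (n j : ℝ) ≠ 0 := Nat.cast_ne_zero.2 (hn j).ne'
    have hk : s j - 1 + 1 = s j := by have := hj j; omega
    have := one_sub_pow_mul_powGeomSum_pow_le (s j - 1) (hn j) h0 h1
    rw [hk] at this
    calc _ = (n j : ℝ) ^ r j * ((1 - q) ^ s j * powGeomSum (s j - 1) (q ^ n j)) := by ring
      _ ≤ (n j : ℝ) ^ r j * (((s j - 1)! * (s j)! * Real.exp 1) * (1 / (n j : ℝ) ^ s j)) := by
        gcongr
      _ = _ := by
        rw [pow_sub₀ _ hnj (by have := hj j; omega)]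
        field_simp

theorem tendsto_one_sub_pow_mul_biBracket_term {l : ℕ} (s r n : Fin l → ℕ)
    (hj : ∀ j, r j + 1 ≤ s j) (hn : ∀ j, 0 < n j) :
    Tendsto (fun q : ℝ =>
        (1 - q) ^ (∑ j, s j) * ∏ j, (n j : ℝ) ^ r j * powGeomSum (s j - 1) (q ^ n j))
      (nhdsWithin 1 (Set.Iio 1))
      (nhds ((∏ j, ((s j - 1)! : ℝ)) * ∏ j, 1 / (n j : ℝ) ^ (s j - r j))) := by
  simp only [← Finset.prod_pow_eq_pow_sum, ← Finset.prod_mul_distrib]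
  refine tendsto_finsetProd _ fun j _ => ?_
  have hnj : (n j : ℝ) ≠ 0 := Nat.cast_ne_zero.2 (hn j).ne'
  have hk : s j - 1 + 1 = s j := by have := hj j; omega
  have := (tendsto_one_sub_pow_mul_powGeomSum_pow (s j - 1) (hn j)).const_mul ((n j : ℝ) ^ r j)
  rw [hk] at this
  convert this using 2
  · ring
  · rw [pow_sub₀ _ hnj (by have := hj j; omega)]
    field_simp

theorem tsum_biBracket_eq {l : ℕ} (hl : 0 < l) (s r : Fin l → ℕ)
    (hz : r ⟨0, hl⟩ + 1 < s ⟨0, hl⟩) (hj : ∀ j, r j + 1 ≤ s j) {q : ℝ} (h0 : 0 < q) (h1 : q < 1) :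
    ∑' x : {n : Fin l → ℕ // (∀ i j, i < j → n j < n i) ∧ ∀ i, 0 < n i} × (Fin l → ℕ+),
      (∏ j : Fin l, (x.1.1 j : ℝ) ^ (r j) * ((x.2 j : ℕ) : ℝ) ^ (s j - 1)) *
        q ^ (∑ j : Fin l, x.1.1 j * (x.2 j : ℕ)) =
    ∑' n : {n : Fin l → ℕ // (∀ i j, i < j → n j < n i) ∧ ∀ i, 0 < n i},
      ∏ j, (n.1 j : ℝ) ^ r j * powGeomSum (s j - 1) (q ^ n.1 j) := by
  have hfib := fun n : {n : Fin l → ℕ // (∀ i j, i < j → n j < n i) ∧ ∀ i, 0 < n i} =>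
    hasSum_biBracket_fiber s r n.1 n.2.2 h0 h1
  have hq : 0 < (1 - q) ^ (∑ j, s j) := pow_pos (sub_pos.2 h1) _
  rw [Summable.tsum_prod]
  · exact tsum_congr fun n => (hfib n).tsum_eq
  refine (summable_prod_of_nonneg fun x => ?_).2 ⟨fun n => (hfib n).summable, ?_⟩
  · simp only [Pi.zero_apply]
    positivity
  simp only [fun n => (hfib n).tsum_eq]
  rw [← summable_mul_left_iff hq.ne']
  refine Summable.of_nonneg_of_le (fun n => mul_nonneg hq.le <| Finset.prod_nonneg fun j _ =>
      mul_nonneg (by positivity) (powGeomSum_nonneg _ (by positivity)))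
    (fun n => one_sub_pow_mul_biBracket_term_le s r n.1 hj n.2.2 h0 h1) ?_
  exact (summable_MZV hl (fun j => s j - r j) (by omega)
    fun j => by have := hj j; omega).mul_left _

/-- Radial asymptotics of bi-brackets: if `s₁ > r₁ + 1` and `s_j ≥ r_j + 1` then
`lim_{q→1⁻} (1−q)^{s₁+⋯+s_l} [s;r](q) = ζ(s₁−r₁,…,s_l−r_l)/(r₁!⋯r_l!)`. -/
theorem biBracket_radial_limit (l : ℕ) (hl : 0 < l) (s r : Fin l → ℕ)
    (h1 : r ⟨0, hl⟩ + 1 < s ⟨0, hl⟩) (hj : ∀ j, r j + 1 ≤ s j) :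
    Tendsto (fun q : ℝ => (1 - q) ^ (∑ j, s j) * biBracket l s r q)
      (nhdsWithin 1 (Set.Iio 1))
      (nhds (MZV l (fun j => s j - r j) / ∏ j : Fin l, ((r j)! : ℝ))) := by
  have hmem : ∀ᶠ x : ℝ in nhdsWithin 1 (Set.Iio 1), x ∈ Set.Ioo (0 : ℝ) 1 :=
    Ioo_mem_nhdsLT one_pos
  have hsum := summable_MZV hl (fun j => s j - r j) (by omega)
    fun j => by have := hj j; omega
  have hlim := tendsto_tsum_of_dominated_convergence
    (hsum.mul_left (∏ j, ((s j - 1)! * (s j)! * Real.exp 1)))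
    (fun n => tendsto_one_sub_pow_mul_biBracket_term s r n.1 hj n.2.2)
    (hmem.mono fun q hq n => by
      rw [Real.norm_of_nonneg]
      · exact one_sub_pow_mul_biBracket_term_le s r n.1 hj n.2.2 hq.1 hq.2
      · exact mul_nonneg (pow_nonneg (sub_nonneg.2 hq.2.le) _) <| Finset.prod_nonneg fun j _ =>
          mul_nonneg (by positivity) (powGeomSum_nonneg _ (pow_nonneg hq.1.le _)))
  have hlim' := hlim.const_mul (∏ j : Fin l, ((r j)! : ℝ) * ((s j - 1)! : ℝ))⁻¹
  have hval : (∏ j : Fin l, ((r j)! : ℝ) * ((s j - 1)! : ℝ))⁻¹ *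
      (∑' n : {n : Fin l → ℕ // (∀ i j, i < j → n j < n i) ∧ ∀ i, 0 < n i},
        (∏ j, ((s j - 1)! : ℝ)) * ∏ j, 1 / (n.1 j : ℝ) ^ (s j - r j)) =
      MZV l (fun j => s j - r j) / ∏ j : Fin l, ((r j)! : ℝ) := by
    have hs : (∏ j, ((s j - 1)! : ℝ)) ≠ 0 := Finset.prod_ne_zero_iff.2 fun j _ => by positivity
    have hr : (∏ j, ((r j)! : ℝ)) ≠ 0 := Finset.prod_ne_zero_iff.2 fun j _ => by positivity
    rw [tsum_mul_left, Finset.prod_mul_distrib, MZV]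
    field_simp
  rw [hval] at hlim'
  refine hlim'.congr' (hmem.mono fun q hq => ?_)
  simp only [biBracket]
  rw [tsum_biBracket_eq hl s r h1 hj hq.1 hq.2, tsum_mul_left]
  ring
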